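/- Let K be a convex body in Euclidean 3-space ℝ³ and let p be a point of ℝ³. Suppose that for every plane H through p, the section H ∩ K is centrally symmetric (with the convention that the empty set is symmetric). Then K is centrally symmetric. -/

import Mathlib

/-- A set is centrally symmetric with center `c` if its reflection through `c` equals itself.
Note the empty set satisfies this for any `c`, matching the convention that ∅ is symmetric. -/
def SymmWith (A : Set (EuclideanSpace ℝ (Fin 3))) (c : EuclideanSpace ℝ (Fin 3)) : Prop :=
  (fun x => (2 : ℝ) • c - x) '' A = A

section SymmetricSections

variable {V : Type*} [NormedAddCommGroup V] [InnerProductSpace ℝ V]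

/-- Every section of `K` by the kernel of a nonzero functional is centrally symmetric
(the vector `c` is twice the center). -/
def HasSymmetricSections (K : Set V) : Prop :=
  ∀ v : StrongDual ℝ V, v ≠ 0 → ∃ c : V, ∀ x ∈ K, v x = 0 → v (c - x) = 0 ∧ c - x ∈ K

theorem exists_dual_ne_zero_apply_eq_zero_pair (hV : Module.finrank ℝ V = 3) (x y : V) :
    ∃ v : StrongDual ℝ V, v ≠ 0 ∧ v x = 0 ∧ v y = 0 := by
  have : FiniteDimensional ℝ V := FiniteDimensional.of_finrank_pos (by omega)
  have hlt : Submodule.span ℝ {x, y} < ⊤ := by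
    rw [lt_top_iff_ne_top]
    intro htop
    have h1 := finrank_range_le_card (R := ℝ) ![x, y]
    rw [Matrix.range_cons_cons_empty, Set.finrank, htop, finrank_top, hV] at h1
    simp at h1
  obtain ⟨f, hf, hle⟩ := Submodule.exists_le_ker_of_lt_top _ hlt
  refine ⟨LinearMap.toContinuousLinearMap f, ?_, ?_, ?_⟩
  · intro h0
    apply hf
    ext z
    exact congrArg (fun g : StrongDual ℝ V => g z) h0
  · exact hle (Submodule.subset_span (by simp))
  · exact hle (Submodule.subset_span (by simp))

theorem exists_mem_interior_apply_ne_zero {K : Set V} (hint : (interior K).Nonempty)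
    {v : StrongDual ℝ V} (hv : v ≠ 0) : ∃ z ∈ interior K, v z ≠ 0 := by
  obtain ⟨z, hz⟩ := hint
  by_contra! hall
  apply hv
  ext y
  have hc : Filter.Tendsto (fun t : ℝ => z + t • y) (nhds 0) (nhds z) := by
    have : Continuous fun t : ℝ => z + t • y := by fun_prop
    simpa using this.tendsto 0
  have hev := hc.eventually (isOpen_interior.mem_nhds hz)
  obtain ⟨δ, hδ, hδ'⟩ := Metric.eventually_nhds_iff.1 hev
  have hmem := hδ' (y := δ / 2) (by
    rw [Real.dist_eq, sub_zero, abs_of_pos (by positivity)]; linarith)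
  have h1 := hall _ hmem
  rw [map_add, hall z hz, map_smul, zero_add, smul_eq_mul] at h1
  simpa [hδ.ne'] using h1

/-- A functional vanishing on two distinct points `a`, `y` of the plane `φ = h` and on a point `x`
outside the plane through `0`, `a` and `y` is zero. -/
theorem dual_eq_zero_of_apply_eq_zero (hV : Module.finrank ℝ V = 3) {φ v₀ v : StrongDual ℝ V}
    {h : ℝ} (hh : h ≠ 0) {a y x : V} (ha : φ a = h) (hy : φ y = h) (hya : y ≠ a)
    (h₀a : v₀ a = 0) (h₀y : v₀ y = 0) (h₀x : v₀ x ≠ 0) (hva : v a = 0) (hvy : v y = 0)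
    (hvx : v x = 0) : v = 0 := by
  have hli : LinearIndependent ℝ ![a, y, x] := by
    rw [Fintype.linearIndependent_iff]
    intro g hg
    simp only [Fin.sum_univ_three, Matrix.cons_val_zero, Matrix.cons_val_one,
      Matrix.cons_val_two, Matrix.head_cons, Matrix.tail_cons] at hg
    have e0 := congrArg v₀ hg
    have e0 : g 2 = 0 := by
      simpa only [map_add, map_smul, h₀a, h₀y, mul_zero, zero_add, map_zero, smul_eq_mul,
        mul_eq_zero, h₀x, or_false] using e0
    rw [e0, zero_smul, add_zero] at hg
    have e1 := congrArg φ hg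
    simp only [map_add, map_smul, ha, hy, map_zero, smul_eq_mul] at e1
    have e2 : g 1 = -g 0 := by
      have : (g 0 + g 1) * h = 0 := by linarith
      rcases mul_eq_zero.1 this with h | h
      · linarith
      · exact absurd h hh
    have e3 : g 0 = 0 := by
      rw [e2, neg_smul, ← sub_eq_add_neg, ← smul_sub, smul_eq_zero] at hg
      rcases hg with h | h
      · exact h
      · exact absurd (sub_eq_zero.1 h).symm hya
    intro i
    fin_cases i
    · exact e3
    · simpa [e3] using e2
    · exact e0
  have htop := hli.span_eq_top_of_card_eq_finrank (by simp [hV])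
  have hle : Submodule.span ℝ (Set.range ![a, y, x]) ≤ LinearMap.ker v.toLinearMap := by
    rw [Submodule.span_le]
    rintro _ ⟨i, rfl⟩
    fin_cases i
    · exact hva
    · exact hvy
    · exact hvx
  rw [htop] at hle
  ext z
  exact hle (Submodule.mem_top : z ∈ ⊤)

/-- If the sections through `a` by planes missing the rest of a degenerate set `C ∋ a` are all
symmetric with the same center, then so is the whole body. -/
theorem symmetric_of_sections_same_center (hV : Module.finrank ℝ V = 3) {K C : Set V}
    (hcl : IsClosed K) (hconv : Convex ℝ K) (hint : (interior K).Nonempty)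
    {φ v₀ : StrongDual ℝ V} {h : ℝ} (hh : h ≠ 0) (hC : ∀ x ∈ C, φ x = h) {a : V} (ha : a ∈ C)
    (hv₀ : v₀ ≠ 0) (h₀ : ∀ x ∈ C, v₀ x = 0) {q : V}
    (hq : ∀ v : StrongDual ℝ V, v ≠ 0 → v a = 0 → (∀ y ∈ C, v y = 0 → y = a) →
      ∀ x ∈ K, v x = 0 → q - x ∈ K) :
    ∀ x ∈ K, q - x ∈ K := by
  have key : ∀ x ∈ K, v₀ x ≠ 0 → q - x ∈ K := by
    intro x hx hx0
    obtain ⟨v, hv, hva, hvx⟩ := exists_dual_ne_zero_apply_eq_zero_pair hV a x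
    refine hq v hv hva (fun y hy hvy => ?_) x hx hvx
    by_contra hya
    exact hv (dual_eq_zero_of_apply_eq_zero hV hh (hC a ha) (hC y hy) hya (h₀ a ha) (h₀ y hy)
      hx0 hva hvy hvx)
  intro x hx
  by_cases hx0 : v₀ x = 0
  swap
  · exact key x hx hx0
  obtain ⟨z, hz, hz0⟩ := exists_mem_interior_apply_ne_zero hint hv₀
  have hcont : Filter.Tendsto (fun t : ℝ => q - (x + t • (z - x))) (nhdsWithin 0 (Set.Ioo 0 1))
      (nhds (q - x)) := by
    have : Continuous fun t : ℝ => q - (x + t • (z - x)) := by fun_prop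
    simpa using (this.tendsto 0).mono_left nhdsWithin_le_nhds
  have : (nhdsWithin (0 : ℝ) (Set.Ioo 0 1)).NeBot := by
    rw [← mem_closure_iff_nhdsWithin_neBot, closure_Ioo (by norm_num)]
    simp
  refine hcl.mem_of_tendsto hcont ?_
  filter_upwards [self_mem_nhdsWithin] with t ht
  refine key _ (hconv.add_smul_sub_mem hx (interior_subset hz) ⟨ht.1.le, ht.2.le⟩) ?_
  simp [hx0, hz0, ht.1.ne']

/-- Strict separation of a point from a compact convex set by a functional whose maximum on the
set is attained at a single point. -/
theorem exists_dual_separating_exposed {B : Set V} (hB : IsCompact B) (hBc : Convex ℝ B)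
    (hne : B.Nonempty) {z : V} (hz : z ∉ B) :
    ∃ ψ : StrongDual ℝ V, ∃ x ∈ B, (∀ y ∈ B, y ≠ x → ψ y < ψ x) ∧ ψ x < ψ z := by
  obtain ⟨x₀, hx₀, hmin⟩ := hB.exists_isMinOn hne
    (f := fun w => dist w z) (by fun_prop)
  set u := z - x₀ with hu
  have hupos : 0 < inner ℝ u u := by
    rw [real_inner_self_eq_norm_sq]
    have : u ≠ 0 := fun h0 => hz (by rw [sub_eq_zero.1 h0]; exact hx₀)
    positivity
  have hproj : ∀ w ∈ B, inner ℝ u u ≤ inner ℝ u (z - w) := by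
    have hinf : ‖z - x₀‖ = ⨅ w : B, ‖z - w‖ := by
      have : Nonempty B := hne.to_subtype
      refine le_antisymm (le_ciInf fun w => ?_) (ciInf_le ⟨0, ?_⟩ (⟨x₀, hx₀⟩ : B))
      · have := hmin w.2
        simpa [dist_eq_norm, norm_sub_rev] using this
      · rintro _ ⟨w, rfl⟩
        exact norm_nonneg _
    intro w hw
    have h1 := (norm_eq_iInf_iff_real_inner_le_zero hBc hx₀).1 hinf w hw
    have h2 : z - w = u - (w - x₀) := by rw [hu]; abel
    rw [h2, inner_sub_right u u]
    linarith
  obtain ⟨D, hD⟩ := hB.isBounded.subset_ball z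
  have hD' : ∀ w ∈ B, ‖w - z‖ ^ 2 ≤ D ^ 2 := by
    intro w hw
    have h1 := hD hw
    rw [Metric.mem_ball, dist_eq_norm] at h1
    exact pow_le_pow_left₀ (norm_nonneg _) h1.le 2
  set R := (D ^ 2 + 1) / inner ℝ u u with hR
  have hRu : R * inner ℝ u u = D ^ 2 + 1 := by rw [hR]; field_simp
  have hR0 : 0 ≤ R := by positivity
  obtain ⟨x, hx, hmax⟩ := hB.exists_isMaxOn hne
    (f := fun w => ‖w - z + R • u‖ ^ 2) (by fun_prop)
  refine ⟨innerSL ℝ (x - z + R • u), x, hx, fun y hy hyx => ?_, ?_⟩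
  · have h1 : ‖y - z + R • u‖ ^ 2 ≤ ‖x - z + R • u‖ ^ 2 := hmax hy
    have h2 : y - z + R • u = (x - z + R • u) + (y - x) := by abel
    rw [h2, norm_add_sq_real, inner_sub_right] at h1
    have h3 : 0 < ‖y - x‖ ^ 2 := by
      have := sub_ne_zero.2 hyx
      positivity
    simp only [innerSL_apply_apply]
    linarith
  · simp only [innerSL_apply_apply]
    rw [← sub_pos, ← inner_sub_right, inner_add_left, inner_smul_left]
    have h1 : inner ℝ (x - z) (z - x) = -‖x - z‖ ^ 2 := by
      rw [← neg_sub x z, inner_neg_right, real_inner_self_eq_norm_sq]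
    have h2 := mul_le_mul_of_nonneg_left (hproj x hx) hR0
    have h3 := hD' x hx
    rw [h1]
    simp only [conj_trivial]
    linarith

/-- Two convex sets `A`, `B` in the plane `φ = h` whose intersection is two-dimensional satisfy
`A ⊆ B` as soon as every line meeting both of them and meeting `B` in a single point also meets
`A` in a single point. -/
theorem subset_of_subsingleton_sections (hV : Module.finrank ℝ V = 3) {A B : Set V}
    {φ : StrongDual ℝ V} {h : ℝ} (hh : h ≠ 0) (hA : ∀ x ∈ A, φ x = h) (hB : ∀ x ∈ B, φ x = h)
    (hAc : Convex ℝ A) (hBk : IsCompact B) (hBc : Convex ℝ B)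
    (hspan : ∀ v : StrongDual ℝ V, v ≠ 0 → ∃ x ∈ A ∩ B, v x ≠ 0)
    (hsub : ∀ v : StrongDual ℝ V, v ≠ 0 → {x ∈ A | v x = 0}.Nonempty →
      {x ∈ B | v x = 0}.Nonempty → {x ∈ B | v x = 0}.Subsingleton →
      {x ∈ A | v x = 0}.Subsingleton) : A ⊆ B := by
  intro z hzA
  by_contra hzB
  obtain ⟨f, hf, -⟩ := exists_dual_ne_zero_apply_eq_zero_pair hV (0 : V) 0
  obtain ⟨w, ⟨hwA, hwB⟩, -⟩ := hspan f hf
  obtain ⟨ψ, x, hx, hlt, hz⟩ := exists_dual_separating_exposed hBk hBc ⟨w, hwB⟩ hzB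
  set v : StrongDual ℝ V := ψ - (ψ x / h) • φ with hvdef
  have hvapp : ∀ y, φ y = h → v y = ψ y - ψ x := by
    intro y hy
    simp [hvdef, hy, hh]
  have hvz : 0 < v z := by rw [hvapp z (hA z hzA)]; linarith
  have hvx : v x = 0 := by rw [hvapp x (hB x hx)]; ring
  have hv0 : v ≠ 0 := by
    intro h0
    rw [h0] at hvz
    simp at hvz
  have hneg : ∀ y ∈ B, y ≠ x → v y < 0 := by
    intro y hy hyx
    rw [hvapp y (hB y hy)]
    linarith [hlt y hy hyx]
  have hcross : ∀ y ∈ A, v y < 0 →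
      (v z - v y)⁻¹ • (-v y • z + v z • y) ∈ {x ∈ A | v x = 0} := by
    intro y hy hvy
    have hs : 0 < v z - v y := by linarith
    refine ⟨?_, ?_⟩
    · have := hAc hzA hy (a := (v z - v y)⁻¹ * -v y) (b := (v z - v y)⁻¹ * v z)
        (mul_nonneg (by positivity) (by linarith)) (by positivity) (by field_simp; ring)
      simpa only [smul_add, smul_smul] using this
    · simp only [map_smul, map_add, smul_eq_mul]
      ring
  have hAne : {x ∈ A | v x = 0}.Nonempty := by
    by_cases hwx : w = x
    · exact ⟨w, hwA, by rw [hwx]; exact hvx⟩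
    · exact ⟨_, hcross w hwA (hneg w hwB hwx)⟩
  have hss := hsub v hv0 hAne ⟨x, hx, hvx⟩ (by
    have : ∀ y ∈ {x ∈ B | v x = 0}, y = x := by
      rintro y ⟨hy, hvy⟩
      by_contra hyx
      exact (hneg y hy hyx).ne hvy
    intro y hy y' hy'
    rw [this y hy, this y' hy'])
  obtain ⟨q, hq⟩ := hAne
  obtain ⟨v₁, hv₁, hv₁z, hv₁q⟩ := exists_dual_ne_zero_apply_eq_zero_pair hV z q
  obtain ⟨y, ⟨hyA, hyB⟩, hy⟩ := hspan v₁ hv₁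
  apply hy
  by_cases hyx : y = x
  · rw [hss ⟨hyA, by rw [hyx]; exact hvx⟩ hq]
    exact hv₁q
  · have hvy := hneg y hyB hyx
    have h1 := hss (hcross y hyA hvy) hq
    have h2 := congrArg v₁ h1
    simp only [map_smul, map_add, smul_eq_mul, hv₁z, hv₁q, mul_zero, zero_add] at h2
    have hs : v z - v y ≠ 0 := by linarith
    simpa [hs, hvz.ne'] using h2

/-- The conclusion when `K` has parallel support planes at points `a` and `μ⁻¹ • a` of a line
through the origin. -/
theorem symmetric_of_parallel_support (hV : Module.finrank ℝ V = 3) {K : Set V}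
    (hK : IsCompact K) (hconv : Convex ℝ K) (hint : (interior K).Nonempty)
    (hs : HasSymmetricSections K) {φ : StrongDual ℝ V} {h μ : ℝ} (hh : h ≠ 0) (hμ : 1 < |μ|)
    {a : V} (haφ : φ a = h) (haK : a ∈ K) (hbK : μ⁻¹ • a ∈ K)
    (hlow : ∀ x ∈ K, μ⁻¹ * h ≤ φ x) (hup : ∀ x ∈ K, φ x ≤ h)
    (hw : ∀ w : V, φ w = 0 → a + w ∈ K → μ⁻¹ • a + w ∈ K → μ⁻¹ • (a + w) ∈ K) :
    ∃ q : V, ∀ x ∈ K, q - x ∈ K := by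
  have hμ0 : μ ≠ 0 := by
    rintro rfl
    simp at hμ
    linarith
  set A : Set V := {x | x ∈ K ∧ φ x = h} with hAdef
  set B : Set V := {x | μ⁻¹ • x ∈ K ∧ φ x = h} with hBdef
  have hrefl : ∀ v : StrongDual ℝ V, v ≠ 0 → {x ∈ A | v x = 0}.Nonempty →
      {x ∈ B | v x = 0}.Nonempty → ∃ c : V,
        (∀ x ∈ {x ∈ A | v x = 0}, μ • (c - x) ∈ {x ∈ B | v x = 0}) ∧
        (∀ y ∈ {x ∈ B | v x = 0}, c - μ⁻¹ • y ∈ {x ∈ A | v x = 0}) := by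
    rintro v hv ⟨x₀, ⟨hx₀, hx₀φ⟩, hx₀v⟩ ⟨y₀, ⟨hy₀, hy₀φ⟩, hy₀v⟩
    obtain ⟨c, hc⟩ := hs v hv
    have h1 := hlow _ (hc x₀ hx₀ hx₀v).2
    have h2 := hup _ (hc _ hy₀ (by simp [hy₀v])).2
    simp only [map_sub, map_smul, smul_eq_mul, hx₀φ, hy₀φ] at h1 h2
    have hcφ : φ c = h + μ⁻¹ * h := by linarith
    refine ⟨c, ?_, ?_⟩
    · rintro x ⟨⟨hx, hxφ⟩, hxv⟩
      obtain ⟨e1, e2⟩ := hc x hx hxv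
      refine ⟨⟨by rwa [inv_smul_smul₀ hμ0], ?_⟩, by rw [map_smul, e1, smul_zero]⟩
      rw [map_smul, map_sub, hcφ, hxφ, smul_eq_mul]
      field_simp
      ring
    · rintro y ⟨⟨hy, hyφ⟩, hyv⟩
      obtain ⟨e1, e2⟩ := hc _ hy (by simp [hyv])
      refine ⟨⟨e2, ?_⟩, e1⟩
      rw [map_sub, map_smul, hcφ, hyφ, smul_eq_mul]
      ring
  by_cases hspan : ∀ v : StrongDual ℝ V, v ≠ 0 → ∃ x ∈ A ∩ B, v x ≠ 0
  · exfalso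
    have hAc : Convex ℝ A := hconv.inter (convex_hyperplane φ.toLinearMap.isLinear h)
    have hBc : Convex ℝ B := (hconv.is_linear_preimage
      (IsLinearMap.isLinearMap_smul μ⁻¹)).inter (convex_hyperplane φ.toLinearMap.isLinear h)
    have hcl : IsClosed {x | φ x = h} := isClosed_eq φ.continuous continuous_const
    have hAk : IsCompact A := hK.inter_right hcl
    have hBk : IsCompact B := by
      refine IsCompact.inter_right ?_ hcl
      exact (Homeomorph.smulOfNeZero μ⁻¹ (inv_ne_zero hμ0)).isClosedEmbedding.isCompact_preimage hK
    have hAB : A ⊆ B := by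
      refine subset_of_subsingleton_sections hV hh (fun x hx => hx.2) (fun x hx => hx.2) hAc hBk
        hBc hspan ?_
      intro v hv hAne hBne hss x hx y hy
      obtain ⟨c, hc, -⟩ := hrefl v hv hAne hBne
      have := smul_right_injective V hμ0 (hss (hc x hx) (hc y hy))
      exact sub_right_injective this
    have hBA : B ⊆ A := by
      refine subset_of_subsingleton_sections hV hh (fun x hx => hx.2) (fun x hx => hx.2) hBc hAk
        hAc (by simpa only [Set.inter_comm] using hspan) ?_
      intro v hv hBne hAne hss x hx y hy
      obtain ⟨c, -, hc⟩ := hrefl v hv hAne hBne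
      exact smul_right_injective V (inv_ne_zero hμ0)
        (sub_right_injective (hss (hc x hx) (hc y hy)))
    have hAeq : A = B := hAB.antisymm hBA
    obtain ⟨v₀, hv₀, hv₀a, -⟩ := exists_dual_ne_zero_apply_eq_zero_pair hV a 0
    obtain ⟨y, ⟨hyA, hyB⟩, hv₀y⟩ := hspan v₀ hv₀
    obtain ⟨v, hv, hva, hvy⟩ := exists_dual_ne_zero_apply_eq_zero_pair hV a y
    have haA : a ∈ {x ∈ A | v x = 0} := ⟨⟨haK, haφ⟩, hva⟩
    have hyA' : y ∈ {x ∈ A | v x = 0} := ⟨hyA, hvy⟩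
    obtain ⟨c, hc, -⟩ := hrefl v hv ⟨a, haA⟩ ⟨y, hyB, hvy⟩
    rw [← hAeq] at hc
    have hbdd : Bornology.IsBounded {x ∈ A | v x = 0} := hAk.isBounded.subset (fun x hx => hx.1)
    have hya : 0 < dist a y := by
      rw [dist_pos]
      rintro rfl
      exact hv₀y hv₀a
    have hle : ∀ x ∈ {x ∈ A | v x = 0}, ∀ y ∈ {x ∈ A | v x = 0},
        dist x y ≤ Metric.diam {x ∈ A | v x = 0} / |μ| := by
      intro x hx y hy
      have h1 := Metric.dist_le_diam_of_mem hbdd (hc x hx) (hc y hy)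
      rw [dist_smul₀, dist_sub_left, Real.norm_eq_abs] at h1
      rw [le_div_iff₀ (by linarith)]
      linarith
    have hd := Metric.diam_le_of_forall_dist_le (by positivity) hle
    have hd0 := Metric.dist_le_diam_of_mem hbdd haA hyA'
    rw [le_div_iff₀ (by linarith)] at hd
    nlinarith
  · push Not at hspan
    obtain ⟨v₀, hv₀, h₀⟩ := hspan
    have haA : a ∈ A := ⟨haK, haφ⟩
    have haB : a ∈ B := ⟨hbK, haφ⟩
    refine ⟨a + μ⁻¹ • a, symmetric_of_sections_same_center hV hK.isClosed hconv hint hh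
      (C := A ∩ B) (fun x hx => hx.1.2) ⟨haA, haB⟩ hv₀ h₀ ?_⟩
    intro v hv hva huniq x hx hvx
    obtain ⟨c, hc⟩ := hs v hv
    have e1 := hc a haK hva
    have e2 := hc _ hbK (by simp [hva])
    have f1 := hlow _ e1.2
    have f2 := hup _ e2.2
    simp only [map_sub, map_smul, smul_eq_mul, haφ] at f1 f2
    have hcφ : φ c = h + μ⁻¹ * h := by linarith
    set w := c - a - μ⁻¹ • a with hwdef
    have hwφ : φ w = 0 := by
      simp only [hwdef, map_sub, map_smul, smul_eq_mul, hcφ, haφ]; ring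
    have hwv : v w = 0 := by
      have := e1.1
      simp only [map_sub, hva, sub_zero] at this
      simp [hwdef, hva, this]
    have g1 : a + w ∈ K := by
      have : a + w = c - μ⁻¹ • a := by rw [hwdef]; abel
      rw [this]; exact e2.2
    have g2 : μ⁻¹ • a + w ∈ K := by
      have : μ⁻¹ • a + w = c - a := by rw [hwdef]; abel
      rw [this]; exact e1.2
    have hφ' : φ (a + w) = h := by rw [map_add, hwφ, haφ, add_zero]
    have hw0 := huniq (a + w) ⟨⟨g1, hφ'⟩, ⟨hw w hwφ g1 g2, hφ'⟩⟩
      (by rw [map_add, hva, hwv, add_zero])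
    have hw1 : w = 0 := by simpa using hw0
    have hceq : a + μ⁻¹ • a = c := by
      rw [hwdef, sub_sub, sub_eq_zero] at hw1
      exact hw1.symm
    rw [hceq]
    exact (hc x hx hvx).2

theorem symmetric_of_zero_mem_interior (hV : Module.finrank ℝ V = 3) {K : Set V}
    (hK : IsCompact K) (hconv : Convex ℝ K) (hs : HasSymmetricSections K)
    (h0 : (0 : V) ∈ interior K) : ∃ q : V, ∀ x ∈ K, q - x ∈ K := by
  have hnhds : K ∈ nhds (0 : V) := mem_interior_iff_mem_nhds.1 h0
  have hmem : ∀ {x : V}, gauge K x ≤ 1 ↔ x ∈ K := by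
    intro x
    rw [gauge_le_one_iff_mem_closure hconv hnhds, hK.isClosed.closure_eq]
  obtain ⟨a, haK, hmax⟩ := hK.exists_isMaxOn ⟨0, interior_subset h0⟩
    (f := fun x => gauge K (-x)) ((continuous_gauge hconv hnhds).comp continuous_neg).continuousOn
  set l := gauge K (-a) with hl
  have hmax' : ∀ x ∈ K, gauge K (-x) ≤ l := fun x hx => hmax hx
  rcases le_or_gt l 1 with hl1 | hl1
  · refine ⟨0, fun x hx => ?_⟩
    rw [zero_sub, ← hmem]
    exact (hmax' x hx).trans hl1
  have hl0 : 0 < l := by linarith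
  have hneg : ∀ x ∈ K, (-l)⁻¹ • x ∈ K := by
    intro x hx
    rw [← hmem, inv_neg, neg_smul, ← smul_neg, gauge_smul_of_nonneg (by positivity), smul_eq_mul,
      inv_mul_le_one₀ hl0]
    exact hmax' x hx
  have hb : (-l)⁻¹ • a ∉ interior K := by
    rw [← gauge_lt_one_iff_mem_interior hconv hnhds, inv_neg, neg_smul, ← smul_neg,
      gauge_smul_of_nonneg (by positivity), smul_eq_mul, ← hl, inv_mul_cancel₀ hl0.ne']
    exact lt_irrefl 1
  obtain ⟨f, hf⟩ := geometric_hahn_banach_open_point hconv.interior isOpen_interior hb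
  have hfK : ∀ x ∈ K, f x ≤ f ((-l)⁻¹ • a) := by
    have hsub : K ⊆ {x | f x ≤ f ((-l)⁻¹ • a)} := by
      have hcl : IsClosed {x | f x ≤ f ((-l)⁻¹ • a)} :=
        isClosed_le f.continuous continuous_const
      rw [← hK.isClosed.closure_eq,
        ← hconv.closure_interior_eq_closure_of_nonempty_interior ⟨0, h0⟩]
      exact hcl.closure_subset_iff.2 fun x hx => (hf x hx).le
    exact fun x hx => hsub hx
  have hf0 : 0 < f ((-l)⁻¹ • a) := by simpa using hf 0 h0
  have hfa : f ((-l)⁻¹ • a) = (-l)⁻¹ * f a := by simp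
  have hfaneg : f a < 0 := by
    rw [hfa, inv_neg] at hf0
    have : 0 < l⁻¹ := by positivity
    nlinarith
  refine symmetric_of_parallel_support hV hK hconv ⟨0, h0⟩ hs (φ := -f) (h := -f a) (μ := -l)
    (a := a) (by linarith) (by rw [abs_neg, abs_of_pos hl0]; exact hl1) (by simp) haK
    (hneg a haK) ?_ ?_ (fun w _ hw _ => hneg _ hw)
  · intro x hx
    have := hfK x hx
    rw [hfa] at this
    simp only [neg_apply]
    linarith
  · intro x hx
    have h1 := hfK _ (hneg x hx)
    rw [hfa, map_smul, smul_eq_mul, inv_neg] at h1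
    have h2 : l⁻¹ * f a ≤ l⁻¹ * f x := by linarith
    have h3 := le_of_mul_le_mul_left h2 (by positivity)
    simp only [neg_apply]
    linarith

theorem symmetric_of_zero_notMem (hV : Module.finrank ℝ V = 3) {K : Set V}
    (hK : IsCompact K) (hconv : Convex ℝ K) (hint : (interior K).Nonempty)
    (hs : HasSymmetricSections K) (h0 : (0 : V) ∉ K) : ∃ q : V, ∀ x ∈ K, q - x ∈ K := by
  obtain ⟨z, hz⟩ := hint
  have hzK := interior_subset hz
  obtain ⟨y₀, hy₀, hmin⟩ := hK.exists_isMinOn ⟨z, hzK⟩ (f := fun x => ‖x‖) (by fun_prop)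
  have hy₀pos : 0 < ‖y₀‖ := norm_pos_iff.2 fun h => h0 (h ▸ hy₀)
  obtain ⟨D, hD⟩ := hK.isBounded.exists_norm_le
  have hbound : ∀ t : ℝ, ∀ y ∈ K, t • y ∈ K → t ≤ D / ‖y₀‖ := by
    intro t y hy hty
    rw [le_div_iff₀ hy₀pos]
    have h1 := hD _ hty
    rw [norm_smul, Real.norm_eq_abs] at h1
    have h2 : ‖y₀‖ ≤ ‖y‖ := hmin hy
    calc t * ‖y₀‖ ≤ |t| * ‖y₀‖ := by gcongr; exact le_abs_self t
      _ ≤ |t| * ‖y‖ := by gcongr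
      _ ≤ D := h1
  have hPk : IsCompact {P : ℝ × V | P ∈ Set.Icc 1 (D / ‖y₀‖) ×ˢ K ∧ P.1 • P.2 ∈ K} :=
    (isCompact_Icc.prod hK).inter_right (hK.isClosed.preimage (by fun_prop))
  have h1P : (1 : ℝ) ≤ D / ‖y₀‖ := hbound 1 z hzK (by simpa using hzK)
  obtain ⟨⟨μ, b⟩, ⟨⟨⟨hμ1, -⟩, hb⟩, ha⟩, hmax⟩ := hPk.exists_isMaxOn
    ⟨(1, z), ⟨⟨⟨le_rfl, h1P⟩, hzK⟩, by simpa using hzK⟩⟩ (f := fun P => P.1) (by fun_prop)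
  simp only at hμ1 hb ha
  have hμ0 : 0 < μ := by linarith
  have hmax' : ∀ t : ℝ, ∀ y ∈ K, t • y ∈ K → t ≤ μ := by
    intro t y hy hty
    rcases le_total t 1 with h | h
    · linarith
    · exact hmax (a := (t, y)) ⟨⟨⟨h, hbound t y hy hty⟩, hy⟩, hty⟩
  have hdisj : Disjoint (interior K) ((fun x => μ • x) ⁻¹' K) := by
    rw [Set.disjoint_left]
    intro x hx hxK
    have hc : Filter.Tendsto (fun t : ℝ => (1 - t) • x) (nhds 0) (nhds x) := by
      have : Continuous fun t : ℝ => (1 - t) • x := by fun_prop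
      simpa using this.tendsto 0
    obtain ⟨δ, hδ, hδ'⟩ :=
      Metric.eventually_nhds_iff.1 (hc.eventually (isOpen_interior.mem_nhds hx))
    set t := min (δ / 2) (1 / 2) with ht
    have ht0 : 0 < t := by positivity
    have ht1 : t ≤ 1 / 2 := min_le_right _ _
    have ht2 : t < δ := (min_le_left _ _).trans_lt (by linarith)
    have hm := interior_subset (hδ' (y := t) (by
      rw [Real.dist_eq, sub_zero, abs_of_pos ht0]; exact ht2))
    have h1 := hmax' (μ / (1 - t)) _ hm (by
      rw [smul_smul, div_mul_cancel₀ _ (by linarith)]; exact hxK)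
    rw [div_le_iff₀ (by linarith)] at h1
    nlinarith
  have hpre : Convex ℝ ((fun x => μ • x) ⁻¹' K) :=
    hconv.is_linear_preimage (IsLinearMap.isLinearMap_smul μ)
  obtain ⟨f, u, hfu, hfu'⟩ :=
    geometric_hahn_banach_open hconv.interior isOpen_interior hpre hdisj
  have hfK : ∀ x ∈ K, f x ≤ u := by
    have hsub : K ⊆ {x | f x ≤ u} := by
      have hcl : IsClosed {x | f x ≤ u} := isClosed_le f.continuous continuous_const
      rw [← hK.isClosed.closure_eq,
        ← hconv.closure_interior_eq_closure_of_nonempty_interior ⟨z, hz⟩]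
      exact hcl.closure_subset_iff.2 fun x hx => (hfu x hx).le
    exact fun x hx => hsub hx
  have hfK' : ∀ x ∈ K, μ * u ≤ f x := by
    intro x hx
    have h1 := hfu' (μ⁻¹ • x) (by simpa [smul_inv_smul₀ hμ0.ne'] using hx)
    rw [map_smul, smul_eq_mul, inv_mul_eq_div, le_div_iff₀ hμ0] at h1
    linarith
  have hfb : f b = u := le_antisymm (hfK b hb) (hfu' b ha)
  have hz1 := hfu z hz
  have hz2 := hfK' z hzK
  have hμ : 1 < μ := by
    rcases hμ1.eq_or_lt with h | h
    · rw [← h] at hz2; linarith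
    · exact h
  have hu : u < 0 := by nlinarith
  have hh : μ * u < 0 := mul_neg_of_pos_of_neg hμ0 hu
  refine symmetric_of_parallel_support hV hK hconv ⟨z, hz⟩ hs (φ := -f) (h := -(μ * u)) (μ := μ)
    (a := μ • b) ?_ ?_ ?_ ha ?_ ?_ ?_ ?_
  · linarith
  · rwa [abs_of_pos hμ0]
  · simp [hfb]
  · rwa [inv_smul_smul₀ hμ0.ne']
  · intro x hx
    have h1 : μ⁻¹ * -(μ * u) = -u := by field_simp
    rw [h1]
    simpa using hfK x hx
  · intro x hx
    simpa using hfK' x hx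
  · intro w _ _ hw
    rw [inv_smul_smul₀ hμ0.ne'] at hw
    rw [smul_add, inv_smul_smul₀ hμ0.ne']
    have := hconv.add_smul_sub_mem hb hw (t := μ⁻¹)
      ⟨by positivity, inv_le_one_of_one_le₀ hμ1⟩
    simpa using this

theorem symmetric_of_zero_mem_frontier (hV : Module.finrank ℝ V = 3) {K : Set V}
    (hK : IsCompact K) (hconv : Convex ℝ K) (hint : (interior K).Nonempty)
    (hs : HasSymmetricSections K) (h0 : (0 : V) ∈ K) (h0' : (0 : V) ∉ interior K) :
    ∃ q : V, ∀ x ∈ K, q - x ∈ K := by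
  obtain ⟨f, hf⟩ := geometric_hahn_banach_point_open hconv.interior isOpen_interior h0'
  rw [map_zero] at hf
  have hfK : ∀ x ∈ K, 0 ≤ f x := by
    have hsub : K ⊆ {x | 0 ≤ f x} := by
      have hcl : IsClosed {x | 0 ≤ f x} := isClosed_le continuous_const f.continuous
      rw [← hK.isClosed.closure_eq, ← hconv.closure_interior_eq_closure_of_nonempty_interior hint]
      exact hcl.closure_subset_iff.2 fun x hx => (hf x hx).le
    exact fun x hx => hsub hx
  obtain ⟨b, hb, hmax⟩ := hK.exists_isMaxOn ⟨0, h0⟩ f.continuous.continuousOn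
  set h := f b with hhdef
  have hfh : ∀ x ∈ K, f x ≤ h := fun x hx => hmax hx
  have hh : 0 < h := by
    obtain ⟨z, hz⟩ := hint
    exact (hf z hz).trans_le (hfh z (interior_subset hz))
  set B : Set V := {x | x ∈ K ∧ f x = h} with hBdef
  have hrefl : ∀ v : StrongDual ℝ V, v ≠ 0 → {x ∈ B | v x = 0}.Nonempty → ∃ c : V,
      f c = h ∧ v c = 0 ∧ ∀ x ∈ K, v x = 0 → c - x ∈ K := by
    rintro v hv ⟨x, ⟨hx, hxf⟩, hvx⟩
    obtain ⟨c, hc⟩ := hs v hv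
    have h1 := hfh _ (hc 0 h0 (map_zero v)).2
    have h2 := hfK _ (hc x hx hvx).2
    have h3 := (hc 0 h0 (map_zero v)).1
    rw [sub_zero] at h1 h3
    rw [map_sub, hxf] at h2
    exact ⟨c, by linarith, h3, fun x hx hvx => (hc x hx hvx).2⟩
  by_cases hspan : ∀ v : StrongDual ℝ V, v ≠ 0 → ∃ x ∈ B, v x ≠ 0
  · exfalso
    have hBk : IsCompact B := hK.inter_right (isClosed_eq f.continuous continuous_const)
    have hbB : b ∈ B := ⟨hb, rfl⟩
    obtain ⟨⟨x, y⟩, ⟨hx, hy⟩, hxy⟩ := (hBk.prod hBk).exists_isMaxOn ⟨(b, b), hbB, hbB⟩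
      (f := fun P => ‖P.1 - P.2‖) (by fun_prop)
    simp only at hx hy
    have hdist : ∀ x' ∈ B, ∀ y' ∈ B, ‖x' - y'‖ ≤ ‖x - y‖ :=
      fun x' hx' y' hy' => hxy (a := (x', y')) ⟨hx', hy'⟩
    obtain ⟨v, hv, hvx, hvy⟩ := exists_dual_ne_zero_apply_eq_zero_pair hV x y
    obtain ⟨r, hr, hvr⟩ := hspan v hv
    set v' : StrongDual ℝ V := v - (v r / h) • f with hv'def
    have hv'app : ∀ s, v' s = v s - v r / h * f s := fun s => by simp [hv'def]
    have hv' : v' ≠ 0 := by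
      intro h0
      have := hv'app x
      rw [h0, hvx, hx.2] at this
      simp only [zero_apply] at this
      field_simp at this
      apply hvr
      linarith
    have hv'r : v' r = 0 := by rw [hv'app, hr.2]; field_simp; ring
    obtain ⟨c, hcf, hcv, hc⟩ := hrefl v hv ⟨x, hx, hvx⟩
    obtain ⟨c', hcf', hcv', hc'⟩ := hrefl v' hv' ⟨r, hr, hv'r⟩
    have htrans : ∀ s ∈ B, v s = 0 → s + (c' - c) ∈ B := by
      intro s hsB hvs
      have h1 := hc s hsB.1 hvs
      have h2 : v' (c - s) = 0 := by
        rw [hv'app, map_sub, map_sub, hcv, hvs, hcf, hsB.2]; ring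
      have h3 := hc' _ h1 h2
      have h4 : c' - (c - s) = s + (c' - c) := by abel
      rw [h4] at h3
      refine ⟨h3, ?_⟩
      rw [map_add, map_sub, hcf, hcf', hsB.2]; ring
    have hx' := htrans x hx hvx
    have hy' := htrans y hy hvy
    have h1 := hdist _ hx' _ hy
    have h2 := hdist _ hy' _ hx
    have hpar := parallelogram_law_with_norm ℝ (c' - c) (x - y)
    have e1 : x + (c' - c) - y = (c' - c) + (x - y) := by abel
    have e2 : y + (c' - c) - x = (c' - c) - (x - y) := by abel
    rw [e1] at h1
    rw [e2] at h2
    have hw : c' - c ≠ 0 := by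
      intro h0
      rw [sub_eq_zero.1 h0, hv'app, hcv, hcf] at hcv'
      field_simp at hcv'
      apply hvr
      linarith
    have hw' : 0 < ‖c' - c‖ := norm_pos_iff.2 hw
    nlinarith [norm_nonneg (c' - c + (x - y)), norm_nonneg (c' - c - (x - y)),
      norm_nonneg (x - y)]
  · push Not at hspan
    obtain ⟨v₀, hv₀, h₀⟩ := hspan
    have hbB : b ∈ B := ⟨hb, rfl⟩
    refine ⟨b, symmetric_of_sections_same_center hV hK.isClosed hconv hint hh.ne' (C := B)
      (fun x hx => hx.2) hbB hv₀ h₀ ?_⟩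
    intro v hv hvb huniq x hx hvx
    obtain ⟨c, hcf, hcv, hc⟩ := hrefl v hv ⟨b, hbB, hvb⟩
    have hcK := hc 0 h0 (map_zero v)
    rw [sub_zero] at hcK
    rw [← huniq c ⟨hcK, hcf⟩ hcv]
    exact hc x hx hvx

theorem HasSymmetricSections.exists_center (hV : Module.finrank ℝ V = 3) {K : Set V}
    (hK : IsCompact K) (hconv : Convex ℝ K) (hint : (interior K).Nonempty)
    (hs : HasSymmetricSections K) : ∃ q : V, ∀ x ∈ K, q - x ∈ K := by
  by_cases h0 : (0 : V) ∈ K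
  · by_cases h0' : (0 : V) ∈ interior K
    · exact symmetric_of_zero_mem_interior hV hK hconv hs h0'
    · exact symmetric_of_zero_mem_frontier hV hK hconv hint hs h0 h0'
  · exact symmetric_of_zero_notMem hV hK hconv hint hs h0

end SymmetricSections

/-- If every plane (2-dimensional affine subspace) through `p` meets the convex body `K ⊆ ℝ³`
in a centrally symmetric section, then `K` is centrally symmetric. -/
theorem symmetric_of_sections_through_point_symmetric
    (K : Set (EuclideanSpace ℝ (Fin 3))) (p : EuclideanSpace ℝ (Fin 3))
    (hKcomp : IsCompact K) (hKconv : Convex ℝ K) (hKint : (interior K).Nonempty)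
    (hsym : ∀ H : AffineSubspace ℝ (EuclideanSpace ℝ (Fin 3)),
      p ∈ H → Module.finrank ℝ H.direction = 2 →
      ∃ c, SymmWith ((H : Set (EuclideanSpace ℝ (Fin 3))) ∩ K) c) :
    ∃ c, SymmWith K c := by
  have hV : Module.finrank ℝ (EuclideanSpace ℝ (Fin 3)) = 3 := by simp
  set e := Homeomorph.addRight p with he
  have hs : HasSymmetricSections (e ⁻¹' K) := by
    intro v hv
    have hv' : (v : EuclideanSpace ℝ (Fin 3) →ₗ[ℝ] ℝ) ≠ 0 := fun h0 =>
      hv (ContinuousLinearMap.coe_injective h0)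
    have hker : Module.finrank ℝ (LinearMap.ker (v : EuclideanSpace ℝ (Fin 3) →ₗ[ℝ] ℝ)) = 2 := by
      have h1 := Module.Dual.finrank_ker_add_one_of_ne_zero hv'
      omega
    obtain ⟨c, hc⟩ := hsym (AffineSubspace.mk' p (LinearMap.ker (v : _ →ₗ[ℝ] ℝ)))
      (AffineSubspace.self_mem_mk' _ _) (by rw [AffineSubspace.direction_mk']; exact hker)
    refine ⟨(2 : ℝ) • c - (2 : ℝ) • p, fun x hx hvx => ?_⟩
    have hmem : x + p ∈ (AffineSubspace.mk' p (LinearMap.ker (v : _ →ₗ[ℝ] ℝ)) :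
        Set (EuclideanSpace ℝ (Fin 3))) ∩ K :=
      ⟨by simpa [AffineSubspace.mem_mk'] using hvx, hx⟩
    have h1 := hc.subset (Set.mem_image_of_mem _ hmem)
    have h2 : (2 : ℝ) • c - (x + p) = (2 : ℝ) • c - (2 : ℝ) • p - x + p := by
      rw [two_smul ℝ p]; abel
    simp only [h2] at h1
    exact ⟨by simpa [AffineSubspace.mem_mk'] using h1.1, h1.2⟩
  obtain ⟨q, hq⟩ := hs.exists_center hV (e.isCompact_preimage.2 hKcomp)
    (hKconv.translate_preimage_left p) (by
      rw [← e.preimage_interior]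
      exact hKint.preimage e.surjective)
  have hq' : ∀ x ∈ K, (2 : ℝ) • (p + (2 : ℝ)⁻¹ • q) - x ∈ K := by
    intro x hx
    have h1 : q - (x - p) + p ∈ K := hq (x - p) (by simpa [he] using hx)
    have h2 : (2 : ℝ) • (p + (2 : ℝ)⁻¹ • q) - x = q - (x - p) + p := by
      rw [smul_add, smul_inv_smul₀ two_ne_zero, two_smul]; abel
    rwa [h2]
  refine ⟨p + (2 : ℝ)⁻¹ • q, Set.Subset.antisymm ?_ fun x hx => ⟨_, hq' x hx, ?_⟩⟩
  · rintro _ ⟨x, hx, rfl⟩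
    exact hq' x hx
  · simp
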